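/- For every N ≥ 1 and β > 0, the variance of the SK free energy satisfies Var(F_N(β)) = N·∫₀¹ E⟨ξ(R(σ,τ))⟩_t dt, where ξ(x) = (β²/2)·(x² − 1/N). -/

import Mathlib

open MeasureTheory ProbabilityTheory Real Finset Filter

noncomputable section

/-- Spin configurations: each of the `N` sites carries a `±1` spin, encoded by a `Bool`. -/
abbrev Config (N : ℕ) := Fin N → Bool

/-- The `±1` value of a spin. -/
def spin (b : Bool) : ℝ := if b then 1 else -1

/-- The value of the last spin `σ_N` (junk value `0` when `N = 0`). -/
def spinLast {N : ℕ} (σ : Config N) : ℝ :=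
  if h : 0 < N then spin (σ ⟨N - 1, Nat.sub_lt h Nat.one_pos⟩) else 0

/-- The Gaussian disorder: i.i.d. standard Gaussians indexed by pairs `(i, j)`
(only the entries with `i < j` are used). -/
def gaussPi (N : ℕ) : Measure (Fin N × Fin N → ℝ) :=
  Measure.pi fun _ => gaussianReal 0 1

instance (N : ℕ) : IsProbabilityMeasure (gaussPi N) := by
  unfold gaussPi; infer_instance

/-- Three independent copies `g, g', g''` of the disorder. -/
def disM3 (N : ℕ) :
    Measure ((Fin N × Fin N → ℝ) × (Fin N × Fin N → ℝ) × (Fin N × Fin N → ℝ)) :=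
  (gaussPi N).prod ((gaussPi N).prod (gaussPi N))

/-- The SK Hamiltonian `H_{N,β}(σ) = (β/√N) ∑_{i<j} g_{ij} σ_i σ_j`. -/
def ham (N : ℕ) (β : ℝ) (g : Fin N × Fin N → ℝ) (σ : Config N) : ℝ :=
  (β / Real.sqrt N) *
    ∑ p ∈ Finset.univ.filter (fun p : Fin N × Fin N => p.1 < p.2),
      g p * spin (σ p.1) * spin (σ p.2)

/-- The cavity Hamiltonian `H⁻_N(σ) = (β/√N) ∑_{i<j<N} g_{ij} σ_i σ_j` on the first
`N - 1` spins. -/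
def hamCav (N : ℕ) (β : ℝ) (g : Fin N × Fin N → ℝ) (σ : Config N) : ℝ :=
  (β / Real.sqrt N) *
    ∑ p ∈ Finset.univ.filter
        (fun p : Fin N × Fin N => p.1 < p.2 ∧ (p.2 : ℕ) < N - 1),
      g p * spin (σ p.1) * spin (σ p.2)

/-- The overlap `R(σ¹,σ²) = (1/N) ∑_{i ≤ N} σ_i¹ σ_i²`. -/
def ovlp (N : ℕ) (σ τ : Config N) : ℝ := (∑ i, spin (σ i) * spin (τ i)) / N

/-- The truncated overlap `R⁻(σ¹,σ²) = (1/N) ∑_{i ≤ N−1} σ_i¹ σ_i²`. -/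
def ovlpm (N : ℕ) (σ τ : Config N) : ℝ :=
  (∑ i ∈ Finset.univ.filter (fun i : Fin N => (i : ℕ) < N - 1),
    spin (σ i) * spin (τ i)) / N

/-- The partition function `Z_N(β)`. -/
def partFun (N : ℕ) (β : ℝ) (g : Fin N × Fin N → ℝ) : ℝ :=
  ∑ σ : Config N, Real.exp (ham N β g σ)

/-- The free energy `F_N(β) = ln Z_N(β)`. -/
def freeEnergy (N : ℕ) (β : ℝ) (g : Fin N × Fin N → ℝ) : ℝ :=
  Real.log (partFun N β g)

/-- Two-replica Gibbs average `⟨f⟩` for the single SK system. -/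
def gibbs2 (N : ℕ) (β : ℝ) (g : Fin N × Fin N → ℝ)
    (f : Config N → Config N → ℝ) : ℝ :=
  (∑ σ : Config N, ∑ τ : Config N,
    f σ τ * Real.exp (ham N β g σ + ham N β g τ)) / (partFun N β g) ^ 2

/-- Disorder expectation of the two-replica Gibbs average. -/
def Egibbs2 (N : ℕ) (β : ℝ) (f : Config N → Config N → ℝ) : ℝ :=
  ∫ g, gibbs2 N β g f ∂gaussPi N

/-- The interpolated Hamiltonian `√t · H_N + √(1−t) · H'_N`. -/
def hamT (N : ℕ) (β t : ℝ) (g g' : Fin N × Fin N → ℝ) (σ : Config N) : ℝ :=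
  Real.sqrt t * ham N β g σ + Real.sqrt (1 - t) * ham N β g' σ

/-- The coupled Gibbs weight `exp(H¹_{N,t}(σ) + H²_{N,t}(τ))`. -/
def wT (N : ℕ) (β t : ℝ) (g g' g'' : Fin N × Fin N → ℝ)
    (ρ : Config N × Config N) : ℝ :=
  Real.exp (hamT N β t g g' ρ.1 + hamT N β t g g'' ρ.2)

/-- The coupled Gibbs average `⟨f⟩_t` of a function of one pair `(σ, τ)`. -/
def gibbsT (N : ℕ) (β t : ℝ) (g g' g'' : Fin N × Fin N → ℝ)
    (f : Config N × Config N → ℝ) : ℝ :=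
  (∑ ρ : Config N × Config N, f ρ * wT N β t g g' g'' ρ) /
    (∑ ρ : Config N × Config N, wT N β t g g' g'' ρ)

/-- The coupled Gibbs average `⟨f⟩_t` of a function of two pairs. -/
def gibbsT2 (N : ℕ) (β t : ℝ) (g g' g'' : Fin N × Fin N → ℝ)
    (f : Config N × Config N → Config N × Config N → ℝ) : ℝ :=
  (∑ ρ₁ : Config N × Config N, ∑ ρ₂ : Config N × Config N,
    f ρ₁ ρ₂ * wT N β t g g' g'' ρ₁ * wT N β t g g' g'' ρ₂) /
    (∑ ρ : Config N × Config N, wT N β t g g' g'' ρ) ^ 2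

/-- Disorder expectation `E⟨f⟩_t` (one pair). -/
def EgibbsT (N : ℕ) (β t : ℝ) (f : Config N × Config N → ℝ) : ℝ :=
  ∫ ω, gibbsT N β t ω.1 ω.2.1 ω.2.2 f ∂disM3 N

/-- Disorder expectation `E⟨f⟩_t` (two pairs). -/
def EgibbsT2 (N : ℕ) (β t : ℝ)
    (f : Config N × Config N → Config N × Config N → ℝ) : ℝ :=
  ∫ ω, gibbsT2 N β t ω.1 ω.2.1 ω.2.2 f ∂disM3 N

/-- The `s`-dependent cavity field term
`(β/√N) σ_N ∑_{i<N} (√t g_{iN} + √(1−t) g'_{iN}) σ_i`. -/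
def cavField (N : ℕ) (β t : ℝ) (g g' : Fin N × Fin N → ℝ) (σ : Config N) : ℝ :=
  if h : 0 < N then
    (β / Real.sqrt N) * spin (σ ⟨N - 1, Nat.sub_lt h Nat.one_pos⟩) *
      ∑ i ∈ Finset.univ.filter (fun i : Fin N => (i : ℕ) < N - 1),
        (Real.sqrt t * g (i, ⟨N - 1, Nat.sub_lt h Nat.one_pos⟩) +
          Real.sqrt (1 - t) * g' (i, ⟨N - 1, Nat.sub_lt h Nat.one_pos⟩)) * spin (σ i)
  else 0

/-- The cavity-interpolated Hamiltonian `H^1_{N,t,s}` (resp. `H^2_{N,t,s}` with `g''`). -/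
def hamTS (N : ℕ) (β t s : ℝ) (g g' : Fin N × Fin N → ℝ) (σ : Config N) : ℝ :=
  Real.sqrt t * hamCav N β g σ + Real.sqrt (1 - t) * hamCav N β g' σ +
    Real.sqrt s * cavField N β t g g' σ

/-- The coupled cavity Gibbs weight `exp(H¹_{N,t,s}(σ) + H²_{N,t,s}(τ))`. -/
def wTS (N : ℕ) (β t s : ℝ) (g g' g'' : Fin N × Fin N → ℝ)
    (ρ : Config N × Config N) : ℝ :=
  Real.exp (hamTS N β t s g g' ρ.1 + hamTS N β t s g g'' ρ.2)

/-- The coupled cavity Gibbs average `⟨f⟩_{t,s}` of a function of one pair. -/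
def gibbsTS1 (N : ℕ) (β t s : ℝ) (g g' g'' : Fin N × Fin N → ℝ)
    (f : Config N × Config N → ℝ) : ℝ :=
  (∑ ρ : Config N × Config N, f ρ * wTS N β t s g g' g'' ρ) /
    (∑ ρ : Config N × Config N, wTS N β t s g g' g'' ρ)

/-- The coupled cavity Gibbs average `⟨f⟩_{t,s}` of a function of two pairs. -/
def gibbsTS2 (N : ℕ) (β t s : ℝ) (g g' g'' : Fin N × Fin N → ℝ)
    (f : Config N × Config N → Config N × Config N → ℝ) : ℝ :=
  (∑ ρ₁ : Config N × Config N, ∑ ρ₂ : Config N × Config N,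
    f ρ₁ ρ₂ * wTS N β t s g g' g'' ρ₁ * wTS N β t s g g' g'' ρ₂) /
    (∑ ρ : Config N × Config N, wTS N β t s g g' g'' ρ) ^ 2

/-- The coupled cavity Gibbs average `⟨f⟩_{t,s}` of a function of `n` pairs. -/
def gibbsTSn (N : ℕ) (β t s : ℝ) (g g' g'' : Fin N × Fin N → ℝ) {n : ℕ}
    (f : (Fin n → Config N × Config N) → ℝ) : ℝ :=
  (∑ ρ : Fin n → Config N × Config N, f ρ * ∏ l, wTS N β t s g g' g'' (ρ l)) /
    (∑ ρ₀ : Config N × Config N, wTS N β t s g g' g'' ρ₀) ^ n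

/-- Disorder expectation `E⟨f⟩_{t,s}` (one pair). -/
def EgibbsTS1 (N : ℕ) (β t s : ℝ) (f : Config N × Config N → ℝ) : ℝ :=
  ∫ ω, gibbsTS1 N β t s ω.1 ω.2.1 ω.2.2 f ∂disM3 N

/-- Disorder expectation `E⟨f⟩_{t,s}` (two pairs). -/
def EgibbsTS2 (N : ℕ) (β t s : ℝ)
    (f : Config N × Config N → Config N × Config N → ℝ) : ℝ :=
  ∫ ω, gibbsTS2 N β t s ω.1 ω.2.1 ω.2.2 f ∂disM3 N

/-- Disorder expectation `E⟨f⟩_{t,s}` (`n` pairs). -/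
def EgibbsTSn (N : ℕ) (β t s : ℝ) {n : ℕ}
    (f : (Fin n → Config N × Config N) → ℝ) : ℝ :=
  ∫ ω, gibbsTSn N β t s ω.1 ω.2.1 ω.2.2 f ∂disM3 N

/-- The covariance kernel `U(ρ, ρ')` of the `s`-part of the coupled cavity Hamiltonians. -/
def Ufun (N : ℕ) (β t : ℝ) (ρ ρ' : Config N × Config N) : ℝ :=
  β ^ 2 / 2 * (spinLast ρ.1 * spinLast ρ'.1 * ovlpm N ρ.1 ρ'.1 +
      spinLast ρ.2 * spinLast ρ'.2 * ovlpm N ρ.2 ρ'.2) +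
    β ^ 2 * t / 2 * (spinLast ρ.1 * spinLast ρ'.2 * ovlpm N ρ.1 ρ'.2 +
      spinLast ρ.2 * spinLast ρ'.1 * ovlpm N ρ.2 ρ'.1)

/-- `ν(β) = −(1/2)·ln(1 − β²) − β²/2`. -/
def nuSK (b : ℝ) : ℝ := -(1 / 2) * Real.log (1 - b ^ 2) - b ^ 2 / 2

/-! ### Gaussian integration by parts -/

lemma hasDerivAt_gaussianPDFReal_zero_one (x : ℝ) :
    HasDerivAt (gaussianPDFReal 0 1) (-(x * gaussianPDFReal 0 1 x)) x := by
  have h : HasDerivAt (fun x : ℝ => -(x - 0) ^ 2 / (2 * ((1 : NNReal) : ℝ))) (-x) x := by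
    have := (((hasDerivAt_id x).sub_const 0).pow 2).neg.div_const (2 * ((1 : NNReal) : ℝ))
    refine (this.congr_deriv ?_)
    simp only [id_eq, sub_zero, NNReal.coe_one]
    norm_num
    ring
  have := h.exp.const_mul (√(2 * π * ((1 : NNReal) : ℝ)))⁻¹
  rw [gaussianPDFReal_def]
  refine this.congr_deriv ?_
  ring

lemma integrable_gaussianReal_iff {h : ℝ → ℝ} :
    Integrable h (gaussianReal 0 1) ↔ Integrable (fun x => gaussianPDFReal 0 1 x * h x) := by
  rw [gaussianReal_of_var_ne_zero _ one_ne_zero,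
    integrable_withDensity_iff_integrable_smul' (measurable_gaussianPDF 0 1)
      (ae_of_all _ fun _ => gaussianPDF_lt_top)]
  simp [toReal_gaussianPDF]

/-- Gaussian integration by parts on the line. -/
lemma integral_id_mul_gaussianReal {h h' : ℝ → ℝ} (hd : ∀ x, HasDerivAt h (h' x) x)
    (hi : Integrable h (gaussianReal 0 1))
    (hxi : Integrable (fun x => x * h x) (gaussianReal 0 1))
    (hi' : Integrable h' (gaussianReal 0 1)) :
    ∫ x, x * h x ∂gaussianReal 0 1 = ∫ x, h' x ∂gaussianReal 0 1 := by
  rw [integral_gaussianReal_eq_integral_smul one_ne_zero,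
    integral_gaussianReal_eq_integral_smul one_ne_zero]
  rw [integrable_gaussianReal_iff] at hi hxi hi'
  have key := integral_mul_deriv_eq_deriv_mul_of_integrable
    (u := gaussianPDFReal 0 1) (u' := fun x => -(x * gaussianPDFReal 0 1 x)) (v := h) (v' := h')
    (fun x _ => hasDerivAt_gaussianPDFReal_zero_one x) (fun x _ => hd x) hi'
    (hxi.neg.congr (ae_of_all _ fun x => by simp; ring)) hi
  simp only [smul_eq_mul]
  rw [key, ← integral_neg]
  exact integral_congr_ae (ae_of_all _ fun x => by simp; ring)

section pi
variable {κ : Type*} [Fintype κ]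

/-- Resampling one coordinate of a product probability measure preserves it. -/
lemma measurePreserving_update [DecidableEq κ] (ν : Measure ℝ) [IsProbabilityMeasure ν] (k : κ) :
    MeasurePreserving (fun z : (κ → ℝ) × ℝ => Function.update z.1 k z.2)
      ((Measure.pi fun _ => ν).prod ν) (Measure.pi fun _ => ν) := by
  have hm : Measurable (fun z : (κ → ℝ) × ℝ => Function.update z.1 k z.2) := measurable_update'
  refine ⟨hm, (Measure.pi_eq fun s hs => ?_).symm⟩
  rw [Measure.map_apply hm (MeasurableSet.univ_pi hs)]
  have : (fun z : (κ → ℝ) × ℝ => Function.update z.1 k z.2) ⁻¹' (Set.univ.pi s) =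
      (Set.univ.pi (Function.update s k Set.univ)) ×ˢ s k := by
    ext z
    simp only [Set.mem_preimage, Set.mem_pi, Set.mem_univ, true_imp_iff, Set.mem_prod]
    constructor
    · intro h
      refine ⟨fun i => ?_, by simpa using h k⟩
      by_cases hi : i = k
      · subst hi; simp
      · simpa [hi] using h i
    · rintro ⟨h, hk⟩ i
      by_cases hi : i = k
      · subst hi; simpa using hk
      · simpa [hi] using h i
  rw [this, Measure.prod_prod, Measure.pi_pi, ← Finset.mul_prod_erase _ _ (Finset.mem_univ k),
    ← Finset.mul_prod_erase _ (fun i => ν (s i)) (Finset.mem_univ k), mul_comm]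
  simp only [Function.update_self, measure_univ, one_mul]
  congr 1
  exact Finset.prod_congr rfl fun i hi => by simp [Finset.ne_of_mem_erase hi]

/-- Functions of polynomial growth are integrable for a finite product of standard Gaussians. -/
lemma integrable_pi_gaussian_of_norm_le_pow {E : Type*} [NormedAddCommGroup E]
    {f : (κ → ℝ) → E} {C : ℝ} (n : ℕ)
    (hf : AEStronglyMeasurable f (Measure.pi fun _ => gaussianReal 0 1))
    (hC : ∀ y, ‖f y‖ ≤ C * (1 + ‖y‖) ^ n) :
    Integrable f (Measure.pi fun _ => gaussianReal 0 1) := by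
  have hnorm : MemLp (fun y : κ → ℝ => 1 + ‖y‖) n (Measure.pi fun _ => gaussianReal 0 1) := by
    have hsum : MemLp (fun y : κ → ℝ => ∑ k, ‖y k‖) n
        (Measure.pi fun _ => gaussianReal 0 1) := by
      refine memLp_finsetSum _ fun k _ => MemLp.norm ?_
      exact (memLp_id_gaussianReal' (μ := 0) (v := 1) n (by simp)).comp_measurePreserving
        (measurePreserving_eval (fun _ : κ => gaussianReal 0 1) k)
    refine (memLp_const (1 : ℝ)).add (hsum.mono (by fun_prop) (ae_of_all _ fun y => ?_))
    rw [norm_norm, Real.norm_of_nonneg (Finset.sum_nonneg fun _ _ => norm_nonneg _)]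
    exact (pi_norm_le_iff_of_nonneg (Finset.sum_nonneg fun _ _ => norm_nonneg _)).2 fun k =>
      Finset.single_le_sum (f := fun k => ‖y k‖) (fun _ _ => norm_nonneg _) (Finset.mem_univ k)
  have hbound := (hnorm.integrable_norm_pow').const_mul C
  refine hbound.mono' hf (ae_of_all _ fun y => (hC y).trans_eq ?_)
  rw [Real.norm_of_nonneg (by positivity)]

/-- Gaussian integration by parts in one coordinate. -/
lemma integral_coord_mul_pi_gaussian [DecidableEq κ] (k : κ) {f : (κ → ℝ) → ℝ}
    (hd : Differentiable ℝ f)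
    (hi : Integrable f (Measure.pi fun _ => gaussianReal 0 1))
    (hki : Integrable (fun y => y k * f y) (Measure.pi fun _ => gaussianReal 0 1))
    (hi' : Integrable (fun y => fderiv ℝ f y (Pi.single k 1))
      (Measure.pi fun _ => gaussianReal 0 1)) :
    ∫ y, y k * f y ∂(Measure.pi fun _ => gaussianReal 0 1) =
      ∫ y, fderiv ℝ f y (Pi.single k 1) ∂(Measure.pi fun _ => gaussianReal 0 1) := by
  have mp := measurePreserving_update (κ := κ) (gaussianReal 0 1) k
  have H : ∀ {u : (κ → ℝ) → ℝ}, Integrable u (Measure.pi fun _ => gaussianReal 0 1) →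
      Integrable (fun z : (κ → ℝ) × ℝ => u (Function.update z.1 k z.2))
        ((Measure.pi fun _ => gaussianReal 0 1).prod (gaussianReal 0 1)) ∧
      ∫ y, u y ∂(Measure.pi fun _ => gaussianReal 0 1) =
        ∫ y, ∫ s, u (Function.update y k s) ∂gaussianReal 0 1
          ∂(Measure.pi fun _ => gaussianReal 0 1) := by
    intro u hu
    have h1 : Integrable (fun z : (κ → ℝ) × ℝ => u (Function.update z.1 k z.2))
        ((Measure.pi fun _ => gaussianReal 0 1).prod (gaussianReal 0 1)) :=
      mp.integrable_comp_of_integrable hu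
    refine ⟨h1, ?_⟩
    rw [← integral_prod (fun z : (κ → ℝ) × ℝ => u (Function.update z.1 k z.2)) h1,
      ← integral_map (f := u) mp.measurable.aemeasurable
        (by rw [mp.map_eq]; exact hu.aestronglyMeasurable), mp.map_eq]
  rw [(H hki).2, (H hi').2]
  refine integral_congr_ae ?_
  filter_upwards [(H hi).1.prod_right_ae, (H hki).1.prod_right_ae, (H hi').1.prod_right_ae]
    with y h1 h2 h3
  simp only [Function.update_self] at h2 ⊢
  refine integral_id_mul_gaussianReal (fun s => ?_) h1 h2 h3
  exact (hd _).hasFDerivAt.comp_hasDerivAt s (hasDerivAt_update y k s)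

/-- Gaussian integration by parts along a direction. -/
lemma integral_linear_mul_pi_gaussian (w : κ → ℝ) {f : (κ → ℝ) → ℝ} {C : ℝ} (n : ℕ)
    (hd : Differentiable ℝ f) (hC : ∀ y, |f y| ≤ C * (1 + ‖y‖) ^ n)
    (hC' : ∀ y, ‖fderiv ℝ f y‖ ≤ C * (1 + ‖y‖) ^ n) :
    ∫ y, (∑ k, w k * y k) * f y ∂(Measure.pi fun _ => gaussianReal 0 1) =
      ∫ y, fderiv ℝ f y w ∂(Measure.pi fun _ => gaussianReal 0 1) := by
  classical
  have hC0 : 0 ≤ C := by simpa using (abs_nonneg _).trans (hC 0)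
  have hfi := integrable_pi_gaussian_of_norm_le_pow n hd.continuous.aestronglyMeasurable hC
  have hki : ∀ k, Integrable (fun y : κ → ℝ => y k * f y)
      (Measure.pi fun _ => gaussianReal 0 1) := fun k => by
    refine integrable_pi_gaussian_of_norm_le_pow (C := C) (n + 1)
      ((continuous_apply k).mul hd.continuous).aestronglyMeasurable fun y => ?_
    rw [norm_mul, pow_succ, ← mul_assoc, mul_comm]
    gcongr
    · exact hC y
    · linarith [norm_le_pi_norm y k]
  have hi' : ∀ k, Integrable (fun y => fderiv ℝ f y (Pi.single k 1))
      (Measure.pi fun _ : κ => gaussianReal 0 1) := fun k => by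
    refine integrable_pi_gaussian_of_norm_le_pow (C := C) n
      (measurable_fderiv_apply_const ℝ f _).aestronglyMeasurable fun y => ?_
    refine ((fderiv ℝ f y).le_opNorm _).trans ?_
    simpa [Pi.norm_single] using hC' y
  have h1 : ∀ y, (∑ k, w k * y k) * f y = ∑ k, w k * (y k * f y) := fun y => by
    rw [Finset.sum_mul]; simp only [mul_assoc]
  have h2 : ∀ y, fderiv ℝ f y w = ∑ k, w k * fderiv ℝ f y (Pi.single k 1) := fun y => by
    conv_lhs => rw [← Finset.univ_sum_single w, map_sum]
    refine Finset.sum_congr rfl fun k _ => ?_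
    rw [← smul_eq_mul, ← map_smul, ← Pi.single_smul, smul_eq_mul, mul_one]
  simp only [h1, h2]
  rw [integral_finsetSum _ fun k _ => (hki k).const_mul _,
    integral_finsetSum _ fun k _ => (hi' k).const_mul _]
  refine Finset.sum_congr rfl fun k _ => ?_
  rw [integral_const_mul, integral_const_mul,
    integral_coord_mul_pi_gaussian k hd hfi (hki k) (hi' k)]

end pi

/-! ### Covariance interpolation for functions with bounded first and second derivatives -/

/-- `F` has gradient `F'`, bounded by `C` together with its derivative. -/
structure HasBoundedGradient {ι : Type*} [Fintype ι] (F : (ι → ℝ) → ℝ) (F' : ι → (ι → ℝ) → ℝ)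
    (C : ℝ) : Prop where
  hasFDerivAt : ∀ x, HasFDerivAt F (∑ p, F' p x • ContinuousLinearMap.proj (R := ℝ) p) x
  differentiable : ∀ p, Differentiable ℝ (F' p)
  abs_le : ∀ p x, |F' p x| ≤ C
  norm_fderiv_le : ∀ p x, ‖fderiv ℝ (F' p) x‖ ≤ C
  nonneg : 0 ≤ C

/-- The linear map `y ↦ (s y_{i p} + c y_{j p})_p`. -/
def mixCoords {ι κ : Type*} [Fintype ι] [Fintype κ] (s c : ℝ) (i j : ι → κ) :
    (κ → ℝ) →L[ℝ] (ι → ℝ) :=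
  ContinuousLinearMap.pi fun p =>
    s • ContinuousLinearMap.proj (R := ℝ) (i p) + c • ContinuousLinearMap.proj (R := ℝ) (j p)

section interpolation

variable {ι κ : Type*} [Fintype ι] [Fintype κ]

lemma norm_proj_le_one (p : ι) :
    ‖ContinuousLinearMap.proj (R := ℝ) (φ := fun _ : ι => ℝ) p‖ ≤ 1 :=
  ContinuousLinearMap.opNorm_le_bound _ zero_le_one fun y => by
    simpa using norm_le_pi_norm y p

@[simp]
lemma mixCoords_apply (s c : ℝ) (i j : ι → κ) (y : κ → ℝ) (p : ι) :
    mixCoords s c i j y p = s * y (i p) + c * y (j p) := by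
  simp [mixCoords]

lemma abs_mul_add_mul_le {s c : ℝ} (hs : |s| ≤ 1) (hc : |c| ≤ 1) (y : κ → ℝ) (a b : κ) :
    |s * y a + c * y b| ≤ 2 * ‖y‖ := by
  have h1 := norm_le_pi_norm y a
  have h2 := norm_le_pi_norm y b
  rw [Real.norm_eq_abs] at h1 h2
  calc |s * y a + c * y b| ≤ |s| * |y a| + |c| * |y b| := by
        simpa only [abs_mul] using abs_add_le (s * y a) (c * y b)
    _ ≤ 1 * ‖y‖ + 1 * ‖y‖ := by gcongr
    _ = 2 * ‖y‖ := by ring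

lemma norm_mixCoords_apply_le {s c : ℝ} (hs : |s| ≤ 1) (hc : |c| ≤ 1) (i j : ι → κ)
    (y : κ → ℝ) : ‖mixCoords s c i j y‖ ≤ 2 * ‖y‖ := by
  refine (pi_norm_le_iff_of_nonneg (by positivity)).2 fun p => ?_
  simpa using abs_mul_add_mul_le hs hc y (i p) (j p)

lemma norm_mixCoords_le {s c : ℝ} (hs : |s| ≤ 1) (hc : |c| ≤ 1) (i j : ι → κ) :
    ‖mixCoords (ι := ι) (κ := κ) s c i j‖ ≤ 2 :=
  ContinuousLinearMap.opNorm_le_bound _ (by norm_num) (norm_mixCoords_apply_le hs hc i j)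

namespace HasBoundedGradient

variable {F : (ι → ℝ) → ℝ} {F' : ι → (ι → ℝ) → ℝ} {C : ℝ}

lemma continuous (h : HasBoundedGradient F F' C) : Continuous F :=
  continuous_iff_continuousAt.2 fun x => (h.hasFDerivAt x).continuousAt

lemma continuous_gradient (h : HasBoundedGradient F F' C) (p : ι) : Continuous (F' p) :=
  (h.differentiable p).continuous

lemma norm_sum_smul_proj_le (h : HasBoundedGradient F F' C) (x : ι → ℝ) :
    ‖∑ p, F' p x • ContinuousLinearMap.proj (R := ℝ) (φ := fun _ : ι => ℝ) p‖ ≤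
      Fintype.card ι * C := by
  refine (norm_sum_le _ _).trans ?_
  rw [← nsmul_eq_mul, ← Finset.card_univ, ← Finset.sum_const]
  refine Finset.sum_le_sum fun p _ => ?_
  rw [norm_smul, ← mul_one C]
  exact mul_le_mul (h.abs_le p x) (norm_proj_le_one p) (norm_nonneg _) h.nonneg

lemma abs_le_mul_one_add_norm (h : HasBoundedGradient F F' C) :
    ∃ A, 0 ≤ A ∧ ∀ x, |F x| ≤ A * (1 + ‖x‖) := by
  have hC := h.nonneg
  refine ⟨|F 0| + Fintype.card ι * C, by positivity, fun x => ?_⟩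
  have h1 : ‖F x - F 0‖ ≤ Fintype.card ι * C * ‖x - 0‖ :=
    convex_univ.norm_image_sub_le_of_norm_hasFDerivWithin_le
      (fun x _ => (h.hasFDerivAt x).hasFDerivWithinAt) (fun x _ => h.norm_sum_smul_proj_le x)
      (Set.mem_univ _) (Set.mem_univ _)
  rw [sub_zero, Real.norm_eq_abs] at h1
  have h2 : |F x| ≤ |F x - F 0| + |F 0| := by simpa using abs_add_le (F x - F 0) (F 0)
  have h3 : 0 ≤ |F 0| * ‖x‖ := by positivity
  have h4 : 0 ≤ Fintype.card ι * C := by positivity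
  nlinarith

/-- Linear growth of `F` along the mixing maps. -/
lemma abs_comp_mixCoords_le (h : HasBoundedGradient F F' C) :
    ∃ A, 0 ≤ A ∧ ∀ (s c : ℝ), |s| ≤ 1 → |c| ≤ 1 → ∀ (i j : ι → κ) (y : κ → ℝ),
      |F (mixCoords s c i j y)| ≤ A * (1 + ‖y‖) := by
  obtain ⟨A, hA, hF⟩ := h.abs_le_mul_one_add_norm
  refine ⟨2 * A, by positivity, fun s c hs hc i j y => (hF _).trans ?_⟩
  have := norm_mixCoords_apply_le hs hc i j y
  have : A * ‖mixCoords s c i j y‖ ≤ A * (2 * ‖y‖) := by gcongr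
  nlinarith

lemma hasFDerivAt_comp_mul_comp (h : HasBoundedGradient F F' C) (p : ι) (s c : ℝ)
    (i j k : ι → κ) (y : κ → ℝ) :
    HasFDerivAt (fun y => F' p (mixCoords s c i j y) * F (mixCoords s c i k y))
      (F' p (mixCoords s c i j y) •
          ((∑ q, F' q (mixCoords s c i k y) • ContinuousLinearMap.proj (R := ℝ) q).comp
            (mixCoords s c i k)) +
        F (mixCoords s c i k y) •
          ((fderiv ℝ (F' p) (mixCoords s c i j y)).comp (mixCoords s c i j))) y :=
  HasFDerivAt.mul
    ((h.differentiable p _).hasFDerivAt.comp y (mixCoords s c i j).hasFDerivAt)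
    ((h.hasFDerivAt _).comp y (mixCoords s c i k).hasFDerivAt)

/-- Gaussian integration by parts along the direction in which the first mixture is constant. -/
lemma integral_mul_gradient_comp_mul_comp (h : HasBoundedGradient F F' C) (p : ι) {s c : ℝ}
    (hs : |s| ≤ 1) (hc : |c| ≤ 1) {i j k : ι → κ} (hi : i.Injective) (hj : j.Injective)
    (hij : ∀ p q, i p ≠ j q) (hik : ∀ p q, i p ≠ k q) (hjk : ∀ p q, j p ≠ k q) :
    ∫ y, (c * y (i p) - s * y (j p)) *
        (F' p (mixCoords s c i j y) * F (mixCoords s c i k y))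
        ∂(Measure.pi fun _ => gaussianReal 0 1) =
      s * c * ∫ y, F' p (mixCoords s c i j y) * F' p (mixCoords s c i k y)
        ∂(Measure.pi fun _ => gaussianReal 0 1) := by
  classical
  obtain ⟨A, hA, hF⟩ := h.abs_comp_mixCoords_le (κ := κ)
  have hC := h.nonneg
  set w : κ → ℝ := Pi.single (i p) c - Pi.single (j p) s with hw
  have hwi : ∀ q, w (i q) = if q = p then c else 0 := fun q => by
    simp [hw, Pi.single_apply, hi.eq_iff, hij]
  have hwj : ∀ q, w (j q) = if q = p then -s else 0 := fun q => by
    simp only [hw, Pi.sub_apply, Pi.single_apply, hj.eq_iff, (hij _ _).symm, if_false]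
    split_ifs <;> simp
  have hwk : ∀ q, w (k q) = 0 := fun q => by
    simp [hw, (hik _ _).symm, (hjk _ _).symm]
  have hsum : ∀ y : κ → ℝ, ∑ a, w a * y a = c * y (i p) - s * y (j p) := fun y => by
    simp [hw, sub_mul, Finset.sum_sub_distrib, Pi.single_apply]
  have huw : mixCoords s c i j w = 0 := by
    ext q
    simp only [mixCoords_apply, hwi, hwj, Pi.zero_apply]
    split_ifs <;> ring
  have hvw : ∀ q, mixCoords s c i k w q = if q = p then s * c else 0 := fun q => by
    simp [hwi, hwk]
  have hfd := fun y => h.hasFDerivAt_comp_mul_comp p s c i j k y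
  have key := integral_linear_mul_pi_gaussian w
    (f := fun y => F' p (mixCoords s c i j y) * F (mixCoords s c i k y))
    (C := C * (Fintype.card ι * C * 2) + A * (C * 2) + C * A) 1
    (fun y => (hfd y).differentiableAt) (fun y => ?_) (fun y => ?_)
  · simp only [hsum] at key
    rw [key, ← integral_const_mul]
    refine integral_congr_ae (ae_of_all _ fun y => ?_)
    simp only [(hfd y).fderiv]
    simp [huw, hvw]
    ring
  · rw [abs_mul]
    have : |F' p (mixCoords s c i j y)| * |F (mixCoords s c i k y)| ≤ C * (A * (1 + ‖y‖)) :=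
      mul_le_mul (h.abs_le p _) (hF s c hs hc i k y) (abs_nonneg _) hC
    have h0 : 0 ≤ (C * (Fintype.card ι * C * 2) + A * (C * 2)) * (1 + ‖y‖) := by positivity
    rw [pow_one]
    linarith
  · rw [(hfd y).fderiv]
    have h1 : ‖F' p (mixCoords s c i j y) •
          ((∑ q, F' q (mixCoords s c i k y) • ContinuousLinearMap.proj (R := ℝ) q).comp
            (mixCoords s c i k))‖ ≤ C * (Fintype.card ι * C * 2) := by
      rw [norm_smul]
      refine mul_le_mul (h.abs_le p _) ((ContinuousLinearMap.opNorm_comp_le _ _).trans ?_)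
        (norm_nonneg _) hC
      exact mul_le_mul (h.norm_sum_smul_proj_le _) (norm_mixCoords_le hs hc i k)
        (norm_nonneg _) (by positivity)
    have h2 : ‖F (mixCoords s c i k y) •
          ((fderiv ℝ (F' p) (mixCoords s c i j y)).comp (mixCoords s c i j))‖ ≤
        A * (1 + ‖y‖) * (C * 2) := by
      rw [norm_smul]
      refine mul_le_mul (hF s c hs hc i k y) ((ContinuousLinearMap.opNorm_comp_le _ _).trans ?_)
        (norm_nonneg _) (by positivity)
      exact mul_le_mul (h.norm_fderiv_le p _) (norm_mixCoords_le hs hc i j)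
        (norm_nonneg _) hC
    refine (norm_add_le_of_le h1 h2).trans ?_
    have h0 : 0 ≤ (C * (Fintype.card ι * C * 2)) * ‖y‖ := by positivity
    have h3 : 0 ≤ C * A * (1 + ‖y‖) := by positivity
    rw [pow_one]
    linarith

lemma hasDerivAt_comp_mixCoords (h : HasBoundedGradient F F' C) (i j : ι → κ) (y : κ → ℝ)
    (θ : ℝ) :
    HasDerivAt (fun θ => F (mixCoords (sin θ) (cos θ) i j y))
      (∑ p, (cos θ * y (i p) - sin θ * y (j p)) * F' p (mixCoords (sin θ) (cos θ) i j y)) θ := by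
  have hm : HasDerivAt (fun θ => mixCoords (sin θ) (cos θ) i j y)
      (fun p => cos θ * y (i p) - sin θ * y (j p)) θ := by
    refine hasDerivAt_pi.2 fun p => ?_
    simp only [mixCoords_apply]
    refine (((hasDerivAt_sin θ).mul_const _).add ((hasDerivAt_cos θ).mul_const _)).congr_deriv ?_
    ring
  refine ((h.hasFDerivAt _).comp_hasDerivAt θ hm).congr_deriv ?_
  simp [mul_comm]

/-- Derivative of the correlation of `F` between two partially correlated Gaussian vectors. -/
lemma hasDerivAt_integral_comp_mul_comp (h : HasBoundedGradient F F' C)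
    {i j k : ι → κ} (hi : i.Injective) (hj : j.Injective) (hk : k.Injective)
    (hij : ∀ p q, i p ≠ j q) (hik : ∀ p q, i p ≠ k q) (hjk : ∀ p q, j p ≠ k q) (θ : ℝ) :
    HasDerivAt
      (fun θ => ∫ y, F (mixCoords (sin θ) (cos θ) i j y) * F (mixCoords (sin θ) (cos θ) i k y)
        ∂(Measure.pi fun _ => gaussianReal 0 1))
      ((∑ p, ∫ y, F' p (mixCoords (sin θ) (cos θ) i j y) *
          F' p (mixCoords (sin θ) (cos θ) i k y) ∂(Measure.pi fun _ => gaussianReal 0 1)) *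
        (2 * sin θ * cos θ)) θ := by
  obtain ⟨A, hA, hF⟩ := h.abs_comp_mixCoords_le (κ := κ)
  have hC := h.nonneg
  have hFc := h.continuous
  have hF'c := h.continuous_gradient
  -- the two halves of the product rule
  set D : (ι → κ) → (ι → κ) → ι → ℝ → (κ → ℝ) → ℝ := fun j k p θ y =>
    (cos θ * y (i p) - sin θ * y (j p)) *
      (F' p (mixCoords (sin θ) (cos θ) i j y) * F (mixCoords (sin θ) (cos θ) i k y)) with hD
  have hDc : ∀ j k p θ, Continuous (D j k p θ) := fun j k p θ => by
    have := hF'c p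
    simp only [hD]
    fun_prop
  have hDb : ∀ j k p θ y, ‖D j k p θ y‖ ≤ 2 * C * A * (1 + ‖y‖) ^ 2 := fun j k p θ y => by
    have h1 : |cos θ * y (i p) - sin θ * y (j p)| ≤ 2 * (1 + ‖y‖) := by
      have := abs_mul_add_mul_le (abs_cos_le_one θ) (by simpa using abs_sin_le_one θ) y (i p) (j p)
        (c := -sin θ)
      rw [neg_mul, ← sub_eq_add_neg] at this
      linarith
    have h2 := h.abs_le p (mixCoords (sin θ) (cos θ) i j y)
    have h3 := hF (sin θ) (cos θ) (abs_sin_le_one θ) (abs_cos_le_one θ) i k y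
    rw [Real.norm_eq_abs, hD, abs_mul, abs_mul]
    calc _ ≤ 2 * (1 + ‖y‖) * (C * (A * (1 + ‖y‖))) := by gcongr
      _ = _ := by ring
  have hDi : ∀ j k p θ, Integrable (D j k p θ) (Measure.pi fun _ => gaussianReal 0 1) :=
    fun j k p θ => integrable_pi_gaussian_of_norm_le_pow 2
      (hDc j k p θ).aestronglyMeasurable (hDb j k p θ)
  have hval : ∀ y θ, HasDerivAt (fun θ => F (mixCoords (sin θ) (cos θ) i j y) *
      F (mixCoords (sin θ) (cos θ) i k y)) (∑ p, (D j k p θ y + D k j p θ y)) θ := fun y θ => by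
    refine ((h.hasDerivAt_comp_mixCoords i j y θ).mul
      (h.hasDerivAt_comp_mixCoords i k y θ)).congr_deriv ?_
    rw [Finset.sum_mul, Finset.mul_sum, ← Finset.sum_add_distrib]
    refine Finset.sum_congr rfl fun p _ => ?_
    simp only [hD]
    ring
  have hbd : ∀ y θ, ‖∑ p, (D j k p θ y + D k j p θ y)‖ ≤
      (∑ _p : ι, (2 * C * A + 2 * C * A)) * (1 + ‖y‖) ^ 2 := fun y θ => by
    rw [Finset.sum_mul]
    refine norm_sum_le_of_le _ fun p _ => ?_
    rw [add_mul]
    exact norm_add_le_of_le (hDb j k p θ y) (hDb k j p θ y)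
  have hcont : ∀ θ, Continuous fun y : κ → ℝ => F (mixCoords (sin θ) (cos θ) i j y) *
      F (mixCoords (sin θ) (cos θ) i k y) := fun θ => by fun_prop
  have key := (hasDerivAt_integral_of_dominated_loc_of_deriv_le (x₀ := θ)
    (μ := Measure.pi fun _ : κ => gaussianReal 0 1) (s := Set.univ) Filter.univ_mem
    (F := fun θ y => F (mixCoords (sin θ) (cos θ) i j y) * F (mixCoords (sin θ) (cos θ) i k y))
    (F' := fun θ y => ∑ p, (D j k p θ y + D k j p θ y))
    (bound := fun y => (∑ _p : ι, (2 * C * A + 2 * C * A)) * (1 + ‖y‖) ^ 2)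
    (Eventually.of_forall fun θ => (hcont θ).aestronglyMeasurable)
    (integrable_pi_gaussian_of_norm_le_pow (C := A * A) 2 (hcont θ).aestronglyMeasurable
      fun y => ?_)
    (continuous_finsetSum _ fun p _ => (hDc j k p θ).add (hDc k j p θ)).aestronglyMeasurable
    (ae_of_all _ fun y θ _ => hbd y θ)
    (integrable_pi_gaussian_of_norm_le_pow
      (C := ∑ _p : ι, (2 * C * A + 2 * C * A)) 2 (by fun_prop) fun y => ?_)
    (ae_of_all _ fun y θ _ => hval y θ)).2
  · refine key.congr_deriv ?_
    rw [integral_finsetSum (f := fun p y => D j k p θ y + D k j p θ y) _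
      fun p _ => (hDi j k p θ).add (hDi k j p θ), Finset.sum_mul]
    refine Finset.sum_congr rfl fun p _ => ?_
    rw [integral_add (hDi j k p θ) (hDi k j p θ)]
    simp only [hD]
    rw [h.integral_mul_gradient_comp_mul_comp p (abs_sin_le_one θ) (abs_cos_le_one θ)
        hi hj hij hik hjk,
      h.integral_mul_gradient_comp_mul_comp p (abs_sin_le_one θ) (abs_cos_le_one θ)
        hi hk hik hij (fun p q => (hjk q p).symm)]
    simp only [mul_comm (F' p (mixCoords (sin θ) (cos θ) i k _))]
    ring
  · have h2 := hF (sin θ) (cos θ) (abs_sin_le_one θ) (abs_cos_le_one θ) i j y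
    have h3 := hF (sin θ) (cos θ) (abs_sin_le_one θ) (abs_cos_le_one θ) i k y
    rw [Real.norm_eq_abs, abs_mul]
    calc _ ≤ (A * (1 + ‖y‖)) * (A * (1 + ‖y‖)) := by gcongr
      _ = _ := by ring
  · rw [Real.norm_of_nonneg]
    positivity


lemma continuous_integral_gradient_mul (h : HasBoundedGradient F F' C) (p : ι) (i j k : ι → κ) :
    Continuous fun t : ℝ => ∫ y, F' p (mixCoords (√t) (√(1 - t)) i j y) *
      F' p (mixCoords (√t) (√(1 - t)) i k y) ∂(Measure.pi fun _ => gaussianReal 0 1) := by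
  have hF'c := h.continuous_gradient p
  have hmix : ∀ (j : ι → κ) y, Continuous fun t : ℝ => mixCoords (√t) (√(1 - t)) i j y :=
    fun j y => continuous_pi fun p => by
      simp only [mixCoords_apply]
      fun_prop
  refine continuous_of_dominated (bound := fun _ => C * C)
    (fun t => (Continuous.aestronglyMeasurable (by fun_prop)))
    (fun t => ae_of_all _ fun y => ?_) (integrable_const _)
    (ae_of_all _ fun y => (hF'c.comp (hmix j y)).mul (hF'c.comp (hmix k y)))
  rw [Real.norm_eq_abs, abs_mul]
  exact mul_le_mul (h.abs_le p _) (h.abs_le p _) (abs_nonneg _) h.nonneg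

lemma memLp_two (h : HasBoundedGradient F F' C) :
    MemLp F 2 (Measure.pi fun _ => gaussianReal 0 1) := by
  obtain ⟨A, hA, hF⟩ := h.abs_le_mul_one_add_norm
  have hc := h.continuous
  refine (memLp_two_iff_integrable_sq hc.aestronglyMeasurable).2 ?_
  refine integrable_pi_gaussian_of_norm_le_pow (C := A ^ 2) 2
    (hc.pow 2).aestronglyMeasurable fun y => ?_
  rw [norm_pow, ← mul_pow]
  exact pow_le_pow_left₀ (norm_nonneg _) (hF y) 2

end HasBoundedGradient

/-- Splitting a Gaussian vector indexed by `ι ⊕ ι ⊕ ι` into three independent copies. -/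
def splitThree (ι : Type*) :
    (ι ⊕ ι ⊕ ι → ℝ) ≃ᵐ (ι → ℝ) × (ι → ℝ) × (ι → ℝ) :=
  (MeasurableEquiv.sumPiEquivProdPi fun _ => ℝ).trans
    ((MeasurableEquiv.refl _).prodCongr (MeasurableEquiv.sumPiEquivProdPi fun _ => ℝ))

lemma measurePreserving_splitThree (ν : Measure ℝ) [IsProbabilityMeasure ν] :
    MeasurePreserving (splitThree ι) (Measure.pi fun _ => ν)
      ((Measure.pi fun _ => ν).prod ((Measure.pi fun _ => ν).prod (Measure.pi fun _ => ν))) :=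
  ((MeasurePreserving.id _).prod (measurePreserving_sumPiEquivProdPi fun _ : ι ⊕ ι => ν)).comp
    (measurePreserving_sumPiEquivProdPi fun _ : ι ⊕ ι ⊕ ι => ν)

lemma mixCoords_inr_inl (s c : ℝ) (y : ι ⊕ ι ⊕ ι → ℝ) :
    mixCoords s c Sum.inl (fun p : ι => Sum.inr (Sum.inl p)) y =
      s • (splitThree ι y).1 + c • (splitThree ι y).2.1 := by
  ext p
  rw [mixCoords_apply]
  rfl

lemma mixCoords_inr_inr (s c : ℝ) (y : ι ⊕ ι ⊕ ι → ℝ) :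
    mixCoords s c Sum.inl (fun p : ι => Sum.inr (Sum.inr p)) y =
      s • (splitThree ι y).1 + c • (splitThree ι y).2.2 := by
  ext p
  rw [mixCoords_apply]
  rfl

/-- Variance of a function of a Gaussian vector as an integral of gradient correlations between
two interpolated copies. -/
theorem HasBoundedGradient.variance_eq_integral {F : (ι → ℝ) → ℝ} {F' : ι → (ι → ℝ) → ℝ} {C : ℝ}
    (h : HasBoundedGradient F F' C) :
    variance F (Measure.pi fun _ => gaussianReal 0 1) =
      ∫ t in (0 : ℝ)..1, ∫ ω : (ι → ℝ) × (ι → ℝ) × (ι → ℝ),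
        ∑ p, F' p (√t • ω.1 + √(1 - t) • ω.2.1) * F' p (√t • ω.1 + √(1 - t) • ω.2.2)
        ∂((Measure.pi fun _ => gaussianReal 0 1).prod
          ((Measure.pi fun _ => gaussianReal 0 1).prod (Measure.pi fun _ => gaussianReal 0 1))) := by
  have mp := measurePreserving_splitThree (ι := ι) (gaussianReal 0 1)
  have hC := h.nonneg
  set j : ι → ι ⊕ ι ⊕ ι := fun p => Sum.inr (Sum.inl p) with hj
  set k : ι → ι ⊕ ι ⊕ ι := fun p => Sum.inr (Sum.inr p) with hk
  set H : ℝ → ℝ := fun t => ∑ p, ∫ y, F' p (mixCoords (√t) (√(1 - t)) Sum.inl j y) *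
      F' p (mixCoords (√t) (√(1 - t)) Sum.inl k y) ∂(Measure.pi fun _ => gaussianReal 0 1) with hH
  have hHc : Continuous H :=
    continuous_finsetSum _ fun p _ => h.continuous_integral_gradient_mul p _ _ _
  have hHeq : ∀ t, ∫ ω : (ι → ℝ) × (ι → ℝ) × (ι → ℝ),
        ∑ p, F' p (√t • ω.1 + √(1 - t) • ω.2.1) * F' p (√t • ω.1 + √(1 - t) • ω.2.2)
        ∂((Measure.pi fun _ => gaussianReal 0 1).prod
          ((Measure.pi fun _ => gaussianReal 0 1).prod
            (Measure.pi fun _ => gaussianReal 0 1))) = H t := fun t => by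
    rw [← mp.integral_comp']
    simp only [← mixCoords_inr_inl, ← mixCoords_inr_inr, ← hj, ← hk]
    refine integral_finsetSum _ fun p _ => ?_
    have hF'c := h.continuous_gradient p
    refine integrable_pi_gaussian_of_norm_le_pow (C := C * C) 0
      (Continuous.aestronglyMeasurable (by fun_prop)) fun y => ?_
    rw [Real.norm_eq_abs, abs_mul, pow_zero, mul_one]
    exact mul_le_mul (h.abs_le p _) (h.abs_le p _) (abs_nonneg _) hC
  set ψ : ℝ → ℝ := fun θ => ∫ y, F (mixCoords (sin θ) (cos θ) Sum.inl j y) *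
    F (mixCoords (sin θ) (cos θ) Sum.inl k y) ∂(Measure.pi fun _ => gaussianReal 0 1) with hψ
  have hψeq : ∀ θ, ψ θ = ∫ ω : (ι → ℝ) × (ι → ℝ) × (ι → ℝ),
        F (sin θ • ω.1 + cos θ • ω.2.1) * F (sin θ • ω.1 + cos θ • ω.2.2)
        ∂((Measure.pi fun _ => gaussianReal 0 1).prod
          ((Measure.pi fun _ => gaussianReal 0 1).prod
            (Measure.pi fun _ => gaussianReal 0 1))) := fun θ => by
    rw [← mp.integral_comp']
    simp only [← mixCoords_inr_inl, ← mixCoords_inr_inr, ← hj, ← hk, hψ]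
  have hψ1 : ψ (π / 2) = ∫ x, F x ^ 2 ∂(Measure.pi fun _ => gaussianReal 0 1) := by
    simp only [hψeq, sin_pi_div_two, cos_pi_div_two, one_smul, zero_smul, add_zero, ← sq]
    rw [integral_fun_fst (fun x => F x ^ 2)]
    simp
  have hψ0 : ψ 0 = (∫ x, F x ∂(Measure.pi fun _ => gaussianReal 0 1)) ^ 2 := by
    simp only [hψeq, sin_zero, cos_zero, one_smul, zero_smul, zero_add]
    rw [integral_fun_snd (fun x : (ι → ℝ) × (ι → ℝ) => F x.1 * F x.2), integral_prod_mul]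
    simp [sq]
  have hder : ∀ θ ∈ Set.uIcc 0 (π / 2),
      HasDerivAt ψ ((H ∘ fun θ => sin θ ^ 2) θ * (2 * sin θ * cos θ)) θ := fun θ hθ => by
    rw [Set.uIcc_of_le (by positivity)] at hθ
    have hs : √(sin θ ^ 2) = sin θ :=
      sqrt_sq (sin_nonneg_of_nonneg_of_le_pi hθ.1 (by linarith [hθ.2, pi_pos]))
    have hc : √(1 - sin θ ^ 2) = cos θ := by
      rw [← cos_sq']
      exact sqrt_sq (cos_nonneg_of_neg_pi_div_two_le_of_le (by linarith [hθ.1, pi_pos]) hθ.2)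
    simp only [hH, Function.comp, hs, hc]
    exact h.hasDerivAt_integral_comp_mul_comp Sum.inl_injective
      (Sum.inr_injective.comp Sum.inl_injective) (Sum.inr_injective.comp Sum.inr_injective)
      (by simp) (by simp) (by simp) θ
  have hcov := intervalIntegral.integral_comp_mul_deriv (a := 0) (b := π / 2)
    (f := fun θ => sin θ ^ 2) (f' := fun θ => 2 * sin θ * cos θ) (g := H)
    (fun θ _ => ((hasDerivAt_sin θ).pow 2).congr_deriv (by simp))
    (by fun_prop) hHc
  rw [intervalIntegral.integral_eq_sub_of_hasDerivAt hder
    (Continuous.intervalIntegrable (by fun_prop) _ _), hψ1, hψ0] at hcov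
  simp only [hHeq]
  rw [variance_eq_sub h.memLp_two]
  simpa using hcov

end interpolation

/-! ### The free energy of a finite Gibbs measure -/

section gibbs

variable {ι Λ : Type*} [Fintype ι] [Fintype Λ]

/-- The average of `f` for the Gibbs weights `exp (∑ p, a σ p * x p)`. -/
def gibbsMean (a : Λ → ι → ℝ) (f : Λ → ℝ) (x : ι → ℝ) : ℝ :=
  (∑ σ, f σ * exp (∑ p, a σ p * x p)) / ∑ σ, exp (∑ p, a σ p * x p)

lemma abs_gibbsMean_le [Nonempty Λ] (a : Λ → ι → ℝ) {f : Λ → ℝ} {B : ℝ} (hf : ∀ σ, |f σ| ≤ B)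
    (x : ι → ℝ) : |gibbsMean a f x| ≤ B := by
  have hZ : 0 < ∑ σ, exp (∑ p, a σ p * x p) :=
    Finset.sum_pos (fun _ _ => exp_pos _) Finset.univ_nonempty
  rw [gibbsMean, abs_div, abs_of_pos hZ, div_le_iff₀ hZ, Finset.mul_sum]
  refine (Finset.abs_sum_le_sum_abs _ _).trans (Finset.sum_le_sum fun σ _ => ?_)
  rw [abs_mul, abs_of_pos (exp_pos _)]
  exact mul_le_mul_of_nonneg_right (hf σ) (exp_pos _).le

lemma hasFDerivAt_sum_mul_exp (a : Λ → ι → ℝ) (f : Λ → ℝ) (x : ι → ℝ) :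
    HasFDerivAt (fun x => ∑ σ, f σ * exp (∑ p, a σ p * x p))
      (∑ p, (∑ σ, f σ * a σ p * exp (∑ p, a σ p * x p)) •
        ContinuousLinearMap.proj (R := ℝ) (φ := fun _ : ι => ℝ) p) x := by
  have h1 : ∀ σ, HasFDerivAt (fun x : ι → ℝ => ∑ p, a σ p * x p)
      (∑ p, a σ p • ContinuousLinearMap.proj (R := ℝ) (φ := fun _ : ι => ℝ) p) x := fun σ =>
    HasFDerivAt.fun_sum fun p _ => (hasFDerivAt_apply p x).const_mul (a σ p)
  refine (HasFDerivAt.fun_sum fun σ _ => ((h1 σ).exp.const_mul (f σ))).congr_fderiv ?_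
  ext y
  simp only [_root_.sum_apply, smul_apply, smul_eq_mul,
    ContinuousLinearMap.proj_apply, Finset.mul_sum, Finset.sum_mul]
  rw [Finset.sum_comm]
  exact Finset.sum_congr rfl fun p _ => Finset.sum_congr rfl fun σ _ => by ring

lemma hasFDerivAt_gibbsMean [Nonempty Λ] (a : Λ → ι → ℝ) (f : Λ → ℝ) (x : ι → ℝ) :
    HasFDerivAt (gibbsMean a f)
      (∑ p, (gibbsMean a (fun σ => f σ * a σ p) x -
          gibbsMean a f x * gibbsMean a (fun σ => a σ p) x) •
        ContinuousLinearMap.proj (R := ℝ) (φ := fun _ : ι => ℝ) p) x := by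
  have hZ : ∑ σ, exp (∑ p, a σ p * x p) ≠ 0 :=
    (Finset.sum_pos (fun _ _ => exp_pos _) Finset.univ_nonempty).ne'
  have h1 := hasFDerivAt_sum_mul_exp a f x
  have h2 := hasFDerivAt_sum_mul_exp a (fun _ => 1) x
  simp only [one_mul] at h2
  refine (h1.mul ((hasDerivAt_inv hZ).comp_hasFDerivAt x h2)).congr_fderiv ?_
  ext y
  simp only [gibbsMean, Function.comp_apply, _root_.sum_apply, smul_apply, smul_eq_mul,
    ContinuousLinearMap.proj_apply, add_apply, Finset.mul_sum,
    ← Finset.sum_add_distrib]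
  refine Finset.sum_congr rfl fun p _ => ?_
  field_simp
  ring

lemma hasFDerivAt_log_sum_exp [Nonempty Λ] (a : Λ → ι → ℝ) (x : ι → ℝ) :
    HasFDerivAt (fun x => log (∑ σ, exp (∑ p, a σ p * x p)))
      (∑ p, gibbsMean a (fun σ => a σ p) x •
        ContinuousLinearMap.proj (R := ℝ) (φ := fun _ : ι => ℝ) p) x := by
  have hZ : ∑ σ, exp (∑ p, a σ p * x p) ≠ 0 :=
    (Finset.sum_pos (fun _ _ => exp_pos _) Finset.univ_nonempty).ne'
  have h := hasFDerivAt_sum_mul_exp a (fun _ => 1) x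
  simp only [one_mul] at h
  refine (h.log hZ).congr_fderiv ?_
  rw [Finset.smul_sum]
  refine Finset.sum_congr rfl fun p _ => ?_
  rw [smul_smul, gibbsMean, div_eq_inv_mul]

lemma exists_hasBoundedGradient_log_sum_exp [Nonempty Λ] (a : Λ → ι → ℝ) :
    ∃ C, HasBoundedGradient (fun x => log (∑ σ, exp (∑ p, a σ p * x p)))
      (fun p => gibbsMean a (fun σ => a σ p)) C := by
  set B := ∑ σ, ∑ p, |a σ p| with hB
  have hB0 : 0 ≤ B := by positivity
  have ha : ∀ σ p, |a σ p| ≤ B := fun σ p =>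
    (Finset.single_le_sum (f := fun p => |a σ p|) (fun _ _ => abs_nonneg _)
      (Finset.mem_univ p)).trans
      (Finset.single_le_sum (f := fun σ => ∑ p, |a σ p|)
        (fun _ _ => Finset.sum_nonneg fun _ _ => abs_nonneg _) (Finset.mem_univ σ))
  have hS : 0 ≤ ∑ _q : ι, (B * B + B * B) := by positivity
  refine ⟨B + ∑ _q : ι, (B * B + B * B), fun x => hasFDerivAt_log_sum_exp a x,
    fun p x => (hasFDerivAt_gibbsMean a _ x).differentiableAt,
    fun p x => (abs_gibbsMean_le a (fun σ => ha σ p) x).trans (by linarith), fun p x => ?_,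
    by positivity⟩
  rw [(hasFDerivAt_gibbsMean a _ x).fderiv]
  refine (norm_sum_le_of_le _ fun q _ => ?_).trans (le_add_of_nonneg_left hB0)
  rw [norm_smul]
  refine (mul_le_mul (norm_sub_le_of_le ?_ ?_) (norm_proj_le_one q) (norm_nonneg _) (by positivity)).trans_eq
    (mul_one _)
  · refine abs_gibbsMean_le a (fun σ => ?_) x
    rw [abs_mul]
    exact mul_le_mul (ha σ p) (ha σ q) (abs_nonneg _) hB0
  · rw [norm_mul]
    exact mul_le_mul (abs_gibbsMean_le a (fun σ => ha σ p) x)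
      (abs_gibbsMean_le a (fun σ => ha σ q) x) (norm_nonneg _) hB0

end gibbs

/-! ### The SK model -/

/-- The coefficient of `g p` in the SK Hamiltonian. -/
def skCoeff (N : ℕ) (β : ℝ) (σ : Config N) (p : Fin N × Fin N) : ℝ :=
  if p.1 < p.2 then β / √N * (spin (σ p.1) * spin (σ p.2)) else 0

lemma ham_eq_sum_skCoeff (N : ℕ) (β : ℝ) (g : Fin N × Fin N → ℝ) (σ : Config N) :
    ham N β g σ = ∑ p, skCoeff N β σ p * g p := by
  simp only [ham, skCoeff, Finset.mul_sum, Finset.sum_filter, ite_mul, zero_mul]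
  exact Finset.sum_congr rfl fun p _ => by split_ifs <;> ring

lemma hamT_eq_sum_skCoeff (N : ℕ) (β t : ℝ) (g g' : Fin N × Fin N → ℝ) (σ : Config N) :
    hamT N β t g g' σ = ∑ p, skCoeff N β σ p * (√t • g + √(1 - t) • g') p := by
  simp only [hamT, ham_eq_sum_skCoeff, Finset.mul_sum, ← Finset.sum_add_distrib, Pi.add_apply,
    Pi.smul_apply, smul_eq_mul]
  exact Finset.sum_congr rfl fun p _ => by ring

lemma spin_mul_self (b : Bool) : spin b * spin b = 1 := by
  cases b <;> simp [spin]

/-- A symmetric double sum splits into its strict upper triangle and its diagonal. -/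
lemma sq_sum_eq_two_mul_sum_lt_add {N : ℕ} (x : Fin N → ℝ) :
    (∑ i, x i) ^ 2 =
      2 * (∑ p : Fin N × Fin N, if p.1 < p.2 then x p.1 * x p.2 else 0) + ∑ i, x i * x i := by
  have hswap : (∑ p : Fin N × Fin N, if p.1 < p.2 then x p.1 * x p.2 else 0) =
      ∑ p : Fin N × Fin N, if p.2 < p.1 then x p.1 * x p.2 else 0 := by
    rw [← (Equiv.prodComm (Fin N) (Fin N)).sum_comp]
    simp [mul_comm]
  have hdiag : ∑ i, x i * x i = ∑ p : Fin N × Fin N, if p.1 = p.2 then x p.1 * x p.2 else 0 := by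
    simp [Fintype.sum_prod_type]
  rw [two_mul]
  nth_rw 2 [hswap]
  rw [hdiag, sq, Finset.sum_mul_sum, ← Fintype.sum_prod_type', ← Finset.sum_add_distrib,
    ← Finset.sum_add_distrib]
  refine Finset.sum_congr rfl fun p _ => ?_
  rcases lt_trichotomy p.1 p.2 with h | h | h
  · simp [h, h.ne, h.not_gt]
  · simp [h]
  · simp [h, h.ne', h.not_gt]

/-- The covariance of the SK Hamiltonian in terms of the overlap. -/
lemma sum_skCoeff_mul_skCoeff {N : ℕ} (hN : 1 ≤ N) (β : ℝ) (σ τ : Config N) :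
    ∑ p, skCoeff N β σ p * skCoeff N β τ p =
      N * (β ^ 2 / 2 * (ovlp N σ τ ^ 2 - 1 / N)) := by
  have hN0 : (0 : ℝ) < N := by exact_mod_cast hN
  have hdiag : ∑ i, (spin (σ i) * spin (τ i)) * (spin (σ i) * spin (τ i)) = N := by
    simp only [mul_mul_mul_comm, spin_mul_self, mul_one]
    simp
  have hsq := sq_sum_eq_two_mul_sum_lt_add fun i => spin (σ i) * spin (τ i)
  have hterm : ∑ p, skCoeff N β σ p * skCoeff N β τ p = β ^ 2 / N *
      ∑ p : Fin N × Fin N, if p.1 < p.2 then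
        (spin (σ p.1) * spin (τ p.1)) * (spin (σ p.2) * spin (τ p.2)) else 0 := by
    rw [Finset.mul_sum]
    refine Finset.sum_congr rfl fun p _ => ?_
    have : β / √N * (β / √N) = β ^ 2 / N := by
      rw [div_mul_div_comm, mul_self_sqrt hN0.le, sq]
    simp only [skCoeff, ← this]
    split_ifs <;> ring
  rw [hterm, ovlp, div_pow, hsq, hdiag]
  field_simp
  ring

lemma sum_gibbsMean_mul_gibbsMean {N : ℕ} (hN : 1 ≤ N) (β t : ℝ)
    (g g' g'' : Fin N × Fin N → ℝ) :
    ∑ p, gibbsMean (skCoeff N β) (fun σ => skCoeff N β σ p) (√t • g + √(1 - t) • g') *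
        gibbsMean (skCoeff N β) (fun σ => skCoeff N β σ p) (√t • g + √(1 - t) • g'') =
      N * gibbsT N β t g g' g'' (fun ρ => β ^ 2 / 2 * (ovlp N ρ.1 ρ.2 ^ 2 - 1 / N)) := by
  simp only [gibbsMean, ← hamT_eq_sum_skCoeff, gibbsT, wT, div_mul_div_comm, exp_add]
  rw [← Finset.sum_div, ← mul_div_assoc]
  congr 1
  · simp only [Finset.sum_mul_sum, Fintype.sum_prod_type (f := fun ρ : Config N × Config N => _ * _)]
    simp only [Finset.mul_sum, ← mul_assoc (N : ℝ) (β ^ 2 / 2 * _)]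
    rw [Finset.sum_comm]
    refine Finset.sum_congr rfl fun σ _ => ?_
    rw [Finset.sum_comm]
    refine Finset.sum_congr rfl fun τ _ => ?_
    rw [← sum_skCoeff_mul_skCoeff hN, Finset.sum_mul]
    exact Finset.sum_congr rfl fun p _ => by ring
  · rw [Finset.sum_mul_sum, Fintype.sum_prod_type]

/-- Chatterjee's variance representation
`Var(F_N(β)) = N ∫₀¹ E⟨ξ(R(σ,τ))⟩_t dt` with `ξ(x) = (β²/2)(x² − 1/N)`. -/
theorem sk_variance_representation (N : ℕ) (hN : 1 ≤ N) (β : ℝ) (hβ : 0 < β) :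
    variance (freeEnergy N β) (gaussPi N) =
      N * ∫ t in (0 : ℝ)..1,
        EgibbsT N β t (fun ρ => β ^ 2 / 2 * (ovlp N ρ.1 ρ.2 ^ 2 - 1 / N)) := by
  obtain ⟨C, hC⟩ := exists_hasBoundedGradient_log_sum_exp (skCoeff N β)
  have hF : freeEnergy N β = fun x => log (∑ σ, exp (∑ p, skCoeff N β σ p * x p)) := by
    ext x
    simp only [freeEnergy, partFun, ham_eq_sum_skCoeff]
  rw [hF, gaussPi, hC.variance_eq_integral]
  simp only [sum_gibbsMean_mul_gibbsMean hN, integral_const_mul,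
    intervalIntegral.integral_const_mul]
  rfl

end
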